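/- Let F(n) denote the number of I₃-free digraphs on the vertex set {0,…,n−1} and T(n) the number of bitournaments on {0,…,n−1}. Then F(n) = T(n)·(1 + o(1)); that is, the ratio F(n)/T(n) (as real numbers) tends to 1 as n → ∞. -/

import Mathlib

open scoped Classical

/-- `E` is a digraph relation on `Fin n`: irreflexive and asymmetric. -/
def DigraphOn (n : ℕ) (E : Fin n → Fin n → Bool) : Prop :=
  (∀ x, E x x = false) ∧ ∀ x y, E x y = true → E y x = false

/-- `E` is I₃-free: any three distinct vertices span at least one arrow. -/
def I3FreeOn (n : ℕ) (E : Fin n → Fin n → Bool) : Prop :=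
  ∀ x y z : Fin n, x ≠ y → y ≠ z → x ≠ z →
    E x y = true ∨ E y x = true ∨ E y z = true ∨ E z y = true ∨
    E x z = true ∨ E z x = true

/-- The set `S` induces a tournament in `E`. -/
def IndTournOn (n : ℕ) (E : Fin n → Fin n → Bool) (S : Finset (Fin n)) : Prop :=
  ∀ x ∈ S, ∀ y ∈ S, x ≠ y → E x y = true ∨ E y x = true

/-- `E` is a bitournament: a digraph whose vertex set splits into two tournaments. -/
def BitournOn (n : ℕ) (E : Fin n → Fin n → Bool) : Prop :=
  DigraphOn n E ∧ ∃ S : Finset (Fin n), IndTournOn n E S ∧ IndTournOn n E Sᶜ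

/-- The set of I₃-free digraphs on `{0, …, n-1}`. -/
noncomputable def Fset (n : ℕ) : Finset (Fin n → Fin n → Bool) :=
  Finset.univ.filter fun E => DigraphOn n E ∧ I3FreeOn n E

/-- The set of bitournaments on `{0, …, n-1}`. -/
noncomputable def Tset (n : ℕ) : Finset (Fin n → Fin n → Bool) :=
  Finset.univ.filter fun E => BitournOn n E

/-- `x ≁ y` : distinct, unrelated vertices. -/
def NadjOn (n : ℕ) (E : Fin n → Fin n → Bool) (x y : Fin n) : Prop :=
  x ≠ y ∧ E x y = false ∧ E y x = false

/-- `Δ(v)`, the set of vertices non-adjacent to `v`. -/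
noncomputable def DeltaOn (n : ℕ) (E : Fin n → Fin n → Bool) (v : Fin n) : Finset (Fin n) :=
  Finset.univ.filter fun x => NadjOn n E x v

/-- `Δ(Q) = (⋃_{v ∈ Q} Δ(v)) \ Q`. -/
noncomputable def DeltaSetOn (n : ℕ) (E : Fin n → Fin n → Bool) (Q : Finset (Fin n)) :
    Finset (Fin n) :=
  (Q.biUnion (DeltaOn n E)) \ Q


/-! ### Basic notions -/

/-- Neighbourhood of a set in the non-adjacency graph. -/
noncomputable def Gam (n : ℕ) (E : Fin n → Fin n → Bool) (Q : Finset (Fin n)) :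
    Finset (Fin n) := Q.biUnion (DeltaOn n E)

lemma mem_Delta {n : ℕ} {E : Fin n → Fin n → Bool} {u v : Fin n} :
    u ∈ DeltaOn n E v ↔ u ≠ v ∧ E u v = false ∧ E v u = false := by
  rw [DeltaOn, Finset.mem_filter]; simp [NadjOn]

lemma mem_Delta_symm {n : ℕ} {E : Fin n → Fin n → Bool} {u v : Fin n} :
    u ∈ DeltaOn n E v ↔ v ∈ DeltaOn n E u := by
  rw [mem_Delta, mem_Delta]; tauto

lemma mem_Gam {n : ℕ} {E : Fin n → Fin n → Bool} {u : Fin n} {Q : Finset (Fin n)} :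
    u ∈ Gam n E Q ↔ ∃ q ∈ Q, u ∈ DeltaOn n E q := by
  simp [Gam]

lemma mem_Fset {n : ℕ} {E : Fin n → Fin n → Bool} :
    E ∈ Fset n ↔ DigraphOn n E ∧ I3FreeOn n E := by simp [Fset]

lemma mem_Tset {n : ℕ} {E : Fin n → Fin n → Bool} :
    E ∈ Tset n ↔ BitournOn n E := by simp [Tset]

/-- triangle-freeness of the non-adjacency graph -/
lemma no_tri {n : ℕ} {E : Fin n → Fin n → Bool} (hE : E ∈ Fset n) {x y z : Fin n}
    (h1 : x ∈ DeltaOn n E y) (h2 : y ∈ DeltaOn n E z) (h3 : x ∈ DeltaOn n E z) : False := by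
  rw [mem_Delta] at h1 h2 h3
  have := (mem_Fset.1 hE).2 x y z h1.1 h2.1 h3.1
  simp [h1, h2, h3] at this

lemma Tset_sub_Fset (n : ℕ) : Tset n ⊆ Fset n := by
  intro E hE
  rw [mem_Tset] at hE
  rw [mem_Fset]
  obtain ⟨hd, S, h1, h2⟩ := hE
  refine ⟨hd, ?_⟩
  intro x y z hxy hyz hxz
  have a1 := h1 x; have a2 := h1 y
  have b1 := h2 x; have b2 := h2 y
  simp only [Finset.mem_compl] at b1 b2
  by_cases hx : x ∈ S <;> by_cases hy : y ∈ S <;> by_cases hz : z ∈ S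
  · have := a1 hx y hy hxy; tauto
  · have := a1 hx y hy hxy; tauto
  · have := a1 hx z hz hxz; tauto
  · have := b2 hy z (by simpa using hz) hyz; tauto
  · have := a2 hy z hz hyz; tauto
  · have := b1 hx z (by simpa using hz) hxz; tauto
  · have := b1 hx y (by simpa using hy) hxy; tauto
  · have := b1 hx y (by simpa using hy) hxy; tauto

/-! ### Fibre counting -/

lemma card_le_of_fiber {n m : ℕ} (S : Finset (Fin n)) (hS : S.card = m)
    (C : Finset (Fin n → Fin n → Bool)) (hC : C ⊆ Fset n) (M : ℕ)
    (h : ∀ E0 ∈ C, (C.filter (fun E => ∀ x y, x ∉ S → y ∉ S → E x y = E0 x y)).card ≤ M) :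
    C.card ≤ M * (Fset (n - m)).card := by
  have hc : (Sᶜ).card = n - m := by rw [Finset.card_compl, hS, Fintype.card_fin]
  let e := (Sᶜ).orderEmbOfFin hc
  let res : (Fin n → Fin n → Bool) → (Fin (n-m) → Fin (n-m) → Bool) :=
    fun E i j => E (e i) (e j)
  have himg : C.image res ⊆ Fset (n-m) := by
    intro E' hE'
    obtain ⟨E, hE, rfl⟩ := Finset.mem_image.1 hE'
    have hF := mem_Fset.1 (hC hE)
    rw [mem_Fset]
    refine ⟨⟨fun x => hF.1.1 _, fun x y => hF.1.2 _ _⟩, ?_⟩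
    intro x y z hxy hyz hxz
    exact hF.2 _ _ _ (by simpa using hxy) (by simpa using hyz) (by simpa using hxz)
  refine (Finset.card_le_mul_card_image (f := res) C M ?_).trans
    (Nat.mul_le_mul_left _ (Finset.card_le_card himg))
  intro b hb
  obtain ⟨E0, hE0, rfl⟩ := Finset.mem_image.1 hb
  refine (Finset.card_le_card ?_).trans (h E0 hE0)
  intro E hE
  rw [Finset.mem_filter] at hE ⊢
  refine ⟨hE.1, ?_⟩
  intro x y hx hy
  have hr : Set.range e = ((Sᶜ : Finset (Fin n)) : Set (Fin n)) := Finset.range_orderEmbOfFin _ hc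
  obtain ⟨i, rfl⟩ : x ∈ Set.range e := by rw [hr]; simpa using hx
  obtain ⟨j, rfl⟩ : y ∈ Set.range e := by rw [hr]; simpa using hy
  exact congrFun (congrFun hE.2 i) j

lemma card_le_prod {β ι α : Type*} [Fintype ι] (C : Finset β) (c : β → ι → α)
    (A : ι → Finset α) (hm : ∀ E ∈ C, ∀ i, c E i ∈ A i) (hi : Set.InjOn c C) :
    C.card ≤ ∏ i, (A i).card := by
  rw [← Fintype.card_piFinset]
  exact Finset.card_le_card_of_injOn c
    (fun E hE => by simpa [Fintype.mem_piFinset] using hm E hE) hi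

/-- status of a pair -/
def stat {n : ℕ} (E : Fin n → Fin n → Bool) (q u : Fin n) : Bool × Bool := (E q u, E u q)

def st3 : Finset (Bool × Bool) := {(false, false), (true, false), (false, true)}
def st2 : Finset (Bool × Bool) := {(true, false), (false, true)}

lemma stat_mem3 {n : ℕ} {E : Fin n → Fin n → Bool} (h : DigraphOn n E) (q u : Fin n) :
    stat E q u ∈ st3 := by
  have := h.2 q u
  simp only [stat, st3]
  cases h1 : E q u <;> cases h2 : E u q <;> simp_all

lemma stat_mem2 {n : ℕ} {E : Fin n → Fin n → Bool} (h : DigraphOn n E) {q u : Fin n}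
    (hne : u ≠ q) (hu : u ∉ DeltaOn n E q) :
    stat E q u ∈ st2 := by
  have := h.2 q u
  rw [mem_Delta] at hu
  simp only [stat, st2]
  cases h1 : E q u <;> cases h2 : E u q <;> simp_all

lemma stat_self {n : ℕ} {E : Fin n → Fin n → Bool} (h : DigraphOn n E) (q : Fin n) :
    stat E q q = (false, false) := by
  simp [stat, h.1]

lemma stat_Delta {n : ℕ} {E : Fin n → Fin n → Bool} {q u : Fin n}
    (hu : u ∈ DeltaOn n E q) : stat E q u = (false, false) := by
  rw [mem_Delta] at hu
  simp [stat, hu]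

/-- allowed statuses for pairs `(q,u)` with non-adjacency allowed exactly when `u ∈ R`. -/
noncomputable def allow {n : ℕ} (R : Finset (Fin n)) (q u : Fin n) : Finset (Bool × Bool) :=
  if u ∈ R then st3 else if u = q then {(false, false)} else st2

lemma card_allow {n : ℕ} (R : Finset (Fin n)) (q u : Fin n) :
    (allow R q u).card ≤ if u ∈ R then 3 else 2 := by
  unfold allow
  split_ifs <;> simp [st3, st2]

lemma stat_mem_allow {n : ℕ} {E : Fin n → Fin n → Bool} (h : DigraphOn n E) {q u : Fin n}
    {R : Finset (Fin n)} (hR : u ∈ DeltaOn n E q → u ∈ R) : stat E q u ∈ allow R q u := by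
  unfold allow
  split_ifs with h1 h2
  · exact stat_mem3 h q u
  · subst h2; simp [stat_self h]
  · exact stat_mem2 h h2 (fun h' => h1 (hR h'))

lemma prod_allow {n : ℕ} (R : Finset (Fin n)) (q : Fin n) :
    ∏ u, (allow R q u).card ≤ 3 ^ R.card * 2 ^ (n - R.card) := by
  calc ∏ u, (allow R q u).card ≤ ∏ u : Fin n, (if u ∈ R then 3 else 2) :=
        Finset.prod_le_prod' (fun u _ => card_allow R q u)
    _ = 3 ^ R.card * 2 ^ (n - R.card) := by
        rw [Finset.prod_ite]
        simp only [Finset.prod_const]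
        congr 2
        · simp
        · rw [Finset.filter_not, Finset.card_sdiff]; simp

/-- Two relations that agree off a set and have the same statuses from it are equal. -/
lemma eq_of_agree {n : ℕ} {E E' : Fin n → Fin n → Bool} (S : Finset (Fin n))
    (h : ∀ x y, x ∉ S → y ∉ S → E x y = E' x y)
    (h' : ∀ q ∈ S, ∀ u, stat E q u = stat E' q u) : E = E' := by
  funext x y
  by_cases hx : x ∈ S
  · exact congrArg Prod.fst (h' x hx y)
  · by_cases hy : y ∈ S
    · exact congrArg Prod.snd (h' y hy x)
    · exact h x y hx hy

/-! ### Counting the four bad classes, for fixed witnesses -/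

lemma Delta_congr {n : ℕ} {E E' : Fin n → Fin n → Bool} {S : Finset (Fin n)}
    (h : ∀ x y, x ∉ S → y ∉ S → E x y = E' x y) {u q : Fin n} (hu : u ∉ S) (hq : q ∉ S) :
    u ∈ DeltaOn n E q ↔ u ∈ DeltaOn n E' q := by
  rw [mem_Delta, mem_Delta, h u q hu hq, h q u hq hu]

lemma count_one {n : ℕ} (v : Fin n) (C : Finset (Fin n → Fin n → Bool)) (hC : C ⊆ Fset n)
    (M : ℕ)
    (h : ∀ E0 ∈ C, ∃ R : Finset (Fin n), 3 ^ R.card * 2 ^ (n - R.card) ≤ M ∧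
      ∀ E ∈ C, (∀ x y, x ≠ v → y ≠ v → E x y = E0 x y) → DeltaOn n E v ⊆ R) :
    C.card ≤ M * (Fset (n - 1)).card := by
  refine card_le_of_fiber {v} (by simp) C hC M ?_
  intro E0 hE0
  obtain ⟨R, hR, hsub⟩ := h E0 hE0
  refine le_trans ?_ ((prod_allow R v).trans hR)
  refine card_le_prod _ (fun E u => stat E v u) (fun u => allow R v u) ?_ ?_
  · intro E hE u
    rw [Finset.mem_filter] at hE
    refine stat_mem_allow (mem_Fset.1 (hC hE.1)).1 (fun hu => hsub E hE.1 ?_ hu)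
    intro x y hx hy
    exact hE.2 x y (by simpa using hx) (by simpa using hy)
  · intro E hE E' hE' heq
    have hE := (Finset.mem_filter.1 hE).2
    have hE' := (Finset.mem_filter.1 hE').2
    refine eq_of_agree {v} (fun x y hx hy => (hE x y hx hy).trans (hE' x y hx hy).symm) ?_
    intro q hq u
    rw [Finset.mem_singleton] at hq
    subst hq
    exact congrFun heq u

lemma count_bad1 {n k : ℕ} (v : Fin n) (N : Finset (Fin n)) (hN : N.card = k) :
    ((Fset n).filter (fun E => DeltaOn n E v ⊆ N)).card ≤ (3 ^ k * 2 ^ n) * (Fset (n - 1)).card := by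
  refine count_one v _ (Finset.filter_subset _ _) _ ?_
  intro E0 _
  refine ⟨N, ?_, fun E hE _ => (Finset.mem_filter.1 hE).2⟩
  rw [hN]
  exact Nat.mul_le_mul_left _ (Nat.pow_le_pow_right (by norm_num) (Nat.sub_le _ _))

lemma count_bad3 {n : ℕ} (v : Fin n) (Q : Finset (Fin n)) (M : ℕ)
    (hM : ∀ r, r ≤ n → 300 * r ≤ 149 * n → 3 ^ r * 2 ^ (n - r) ≤ M) :
    ((Fset n).filter (fun E => Q ⊆ DeltaOn n E v ∧ 151 * n ≤ 300 * (Gam n E Q).card)).card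
      ≤ M * (Fset (n - 1)).card := by
  refine count_one v _ (Finset.filter_subset _ _) _ ?_
  intro E0 hE0
  have h0 := (Finset.mem_filter.1 hE0).2
  have hle : (Gam n E0 Q).card ≤ n := by simpa using Finset.card_le_univ (Gam n E0 Q)
  refine ⟨(Gam n E0 Q)ᶜ, ?_, ?_⟩
  · have : ((Gam n E0 Q)ᶜ).card = n - (Gam n E0 Q).card := by
      rw [Finset.card_compl, Fintype.card_fin]
    rw [this]
    apply hM <;> omega
  · intro E hE hag u hu
    have hE' := Finset.mem_filter.1 hE
    rw [Finset.mem_compl]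
    intro hG
    obtain ⟨q, hq, huq⟩ := mem_Gam.1 hG
    have hqv := hE'.2.1 hq
    have huq' : u ∈ DeltaOn n E q := by
      refine (Delta_congr (S := {v}) ?_ ?_ ?_).2 huq
      · intro x y hx hy; exact hag x y (by simpa using hx) (by simpa using hy)
      · simpa using (mem_Delta.1 hu).1
      · simpa using (mem_Delta.1 hqv).1
    exact no_tri hE'.1 huq' hqv hu

lemma count_bad2 {n k : ℕ} (Q R : Finset (Fin n)) (hQ : Q.card = k) (M : ℕ)
    (hM : ∀ r, r ≤ n → 300 * r ≤ 149 * n → 3 ^ r * 2 ^ (n - r) ≤ M) 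
    (hR : 300 * R.card ≤ 149 * n) :
    ((Fset n).filter (fun E => Gam n E Q = R)).card ≤ M ^ k * (Fset (n - k)).card := by
  refine card_le_of_fiber Q hQ _ (Finset.filter_subset _ _) _ ?_
  intro E0 _
  have hle : R.card ≤ n := by simpa using Finset.card_le_univ R
  have hprod : ∏ i : Q × Fin n, (allow R i.1.1 i.2).card ≤ M ^ k := by
    rw [Fintype.prod_prod_type]
    calc ∏ q : Q, ∏ u : Fin n, (allow R q.1 u).card ≤ ∏ q : Q, M :=
          Finset.prod_le_prod' (fun q _ => (prod_allow R q.1).trans (hM _ hle hR))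
      _ = M ^ k := by simp [hQ]
  refine le_trans ?_ hprod
  refine card_le_prod _ (fun E (i : Q × Fin n) => stat E i.1.1 i.2) (fun i => allow R i.1.1 i.2) ?_ ?_
  · intro E hE i
    have hE := (Finset.mem_filter.1 (Finset.mem_filter.1 hE).1)
    refine stat_mem_allow (mem_Fset.1 hE.1).1 (fun hu => ?_)
    rw [← hE.2, mem_Gam]
    exact ⟨_, i.1.2, hu⟩
  · intro E hE E' hE' heq
    have hE := (Finset.mem_filter.1 hE).2
    have hE' := (Finset.mem_filter.1 hE').2
    refine eq_of_agree Q (fun x y hx hy => (hE x y hx hy).trans (hE' x y hx hy).symm) ?_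
    intro q hq u
    exact congrFun heq (⟨q, hq⟩, u)

/-- allowed pairs of statuses towards the two ends of a non-edge -/
noncomputable def allow2 {n : ℕ} (x y : Fin n) (A B : Finset (Fin n)) (u : Fin n) :
    Finset ((Bool × Bool) × (Bool × Bool)) :=
  if u = x ∨ u = y then {((false, false), (false, false))}
  else if u ∈ A then (if u ∈ B then st2 ×ˢ st2 else st2 ×ˢ st3)
  else (if u ∈ B then st3 ×ˢ st2 else (st3 ×ˢ st3).erase ((false, false), (false, false)))

lemma card_allow2 {n : ℕ} (x y : Fin n) (A B : Finset (Fin n)) (u : Fin n) :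
    (allow2 x y A B u).card ≤ if u ∈ A ∩ B then 4 else if u ∈ (A ∪ B)ᶜ then 8 else 6 := by
  unfold allow2
  have e2 : st2.card = 2 := rfl
  have e3 : st3.card = 3 := rfl
  have e8 : ((st3 ×ˢ st3).erase ((false, false), (false, false))).card = 8 := by
    rw [Finset.card_erase_of_mem (by simp [st3]), Finset.card_product, e3]
  by_cases h : u = x ∨ u = y
  · rw [if_pos h]; split_ifs <;> simp
  · rw [if_neg h]
    by_cases hA : u ∈ A <;> by_cases hB : u ∈ B <;>
      simp [hA, hB, Finset.card_product, e2, e3, e8]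

lemma prod_allow2 {n : ℕ} (x y : Fin n) (A B : Finset (Fin n)) :
    ∏ u, (allow2 x y A B u).card ≤
      4 ^ (A ∩ B).card * 6 ^ (n - (A ∩ B).card - ((A ∪ B)ᶜ).card) * 8 ^ ((A ∪ B)ᶜ).card := by
  calc ∏ u, (allow2 x y A B u).card
      ≤ ∏ u : Fin n, (if u ∈ A ∩ B then 4 else if u ∈ (A ∪ B)ᶜ then 8 else 6) :=
        Finset.prod_le_prod' (fun u _ => card_allow2 x y A B u)
    _ = _ := by
        rw [Finset.prod_ite, Finset.prod_ite]
        simp only [Finset.prod_const]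
        have h1 : (Finset.univ.filter (fun u => u ∈ A ∩ B)) = A ∩ B := by ext; simp
        have h2 : ((Finset.univ.filter (fun u => u ∉ A ∩ B)).filter (fun u => u ∈ (A ∪ B)ᶜ))
            = (A ∪ B)ᶜ := by ext; simp; tauto
        have h3 : ((Finset.univ.filter (fun u => u ∉ A ∩ B)).filter (fun u => u ∉ (A ∪ B)ᶜ)).card
            = n - (A ∩ B).card - ((A ∪ B)ᶜ).card := by
          have e1 := Finset.card_filter_add_card_filter_not (s := (Finset.univ : Finset (Fin n)))
            (fun u => u ∈ A ∩ B)
          have e2 := Finset.card_filter_add_card_filter_not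
            (s := (Finset.univ.filter (fun u => u ∉ A ∩ B)))
            (fun u => u ∈ (A ∪ B)ᶜ)
          rw [h1] at e1
          rw [h2] at e2
          simp only [Finset.card_univ, Fintype.card_fin] at e1
          omega
        rw [h1, h2, h3]; ring

lemma count_bad4 {n : ℕ} (x y : Fin n) (Qx Qy : Finset (Fin n)) (M : ℕ)
    (hM : ∀ p q, p + q ≤ n → n ≤ 50 * p → 150 * q ≤ 150 * p + n →
      4 ^ p * 6 ^ (n - p - q) * 8 ^ q ≤ M) :
    ((Fset n).filter (fun E => x ∈ DeltaOn n E y ∧ Qx ⊆ DeltaOn n E x ∧ Qy ⊆ DeltaOn n E y ∧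
      y ∉ Qx ∧ x ∉ Qy ∧ 149 * n ≤ 300 * (Gam n E Qx).card ∧ 149 * n ≤ 300 * (Gam n E Qy).card ∧
      n ≤ 50 * (Gam n E Qx ∩ Gam n E Qy).card)).card
      ≤ M * (Fset (n - 2)).card := by
  by_cases hxy : x = y
  · subst hxy
    rw [Finset.filter_false_of_mem]
    · simp
    · intro E _ h
      exact (mem_Delta.1 h.1).1 rfl
  refine card_le_of_fiber {x, y} (Finset.card_pair hxy) _ (Finset.filter_subset _ _) _ ?_
  intro E0 hE0
  obtain ⟨hF0, h0, hx0, hy0, hyx, hxy', s1, s2, s3⟩ := Finset.mem_filter.1 hE0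
  set A := Gam n E0 Qx with hA
  set B := Gam n E0 Qy with hB
  have hMM := hM (A ∩ B).card ((A ∪ B)ᶜ).card
  have hu := Finset.card_union_add_card_inter A B
  have hle : (A ∪ B).card ≤ n := by simpa using Finset.card_le_univ (A ∪ B)
  have hcc : ((A ∪ B)ᶜ).card = n - (A ∪ B).card := by
    rw [Finset.card_compl, Fintype.card_fin]
  have hin : (A ∩ B).card ≤ (A ∪ B).card :=
    Finset.card_le_card (Finset.inter_subset_left.trans Finset.subset_union_left)
  refine le_trans ?_ ((prod_allow2 x y A B).trans
    (hMM (by omega) (by omega) (by omega)))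
  have key : ∀ E ∈ Fset n, (∀ a b, a ∉ ({x, y} : Finset (Fin n)) → b ∉ ({x, y} : Finset (Fin n)) →
      E a b = E0 a b) → ∀ (w : Fin n) (Q : Finset (Fin n)), Q ⊆ DeltaOn n E w →
      x ∉ Q → y ∉ Q → ∀ u, u ≠ x → u ≠ y → u ∈ Gam n E0 Q → u ∉ DeltaOn n E w := by
    intro E hE hag w Q hQ hxQ hyQ u hux huy huG hud
    obtain ⟨q, hq, huq⟩ := mem_Gam.1 huG
    have huq' : u ∈ DeltaOn n E q := by
      refine (Delta_congr hag ?_ ?_).2 huq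
      · simp [hux, huy]
      · simp only [Finset.mem_insert, Finset.mem_singleton, not_or]
        exact ⟨fun h => hxQ (h ▸ hq), fun h => hyQ (h ▸ hq)⟩
    exact no_tri hE huq' (hQ hq) hud
  refine card_le_prod _ (fun E u => (stat E x u, stat E y u)) (fun u => allow2 x y A B u) ?_ ?_
  · intro E hE u
    obtain ⟨hE, hag⟩ := Finset.mem_filter.1 hE
    obtain ⟨hF, h1, hx1, hy1, -, -, -, -, -⟩ := Finset.mem_filter.1 hE
    have hD := (mem_Fset.1 hF).1
    have hxQx : x ∉ Qx := fun h => (mem_Delta.1 (hx1 h)).1 rfl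
    have hyQy : y ∉ Qy := fun h => (mem_Delta.1 (hy1 h)).1 rfl
    have kx := key E hF hag x Qx hx1 hxQx hyx u
    have ky := key E hF hag y Qy hy1 hxy' hyQy u
    unfold allow2
    by_cases hu : u = x ∨ u = y
    · rw [if_pos hu]
      rcases hu with rfl | rfl
      · rw [stat_self hD, stat_Delta h1]; simp
      · rw [stat_self hD, stat_Delta (mem_Delta_symm.1 h1)]; simp
    · rw [if_neg hu]
      push Not at hu
      split_ifs with a b b
      · exact Finset.mem_product.2 ⟨stat_mem2 hD hu.1 (kx hu.1 hu.2 a),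
          stat_mem2 hD hu.2 (ky hu.1 hu.2 b)⟩
      · exact Finset.mem_product.2 ⟨stat_mem2 hD hu.1 (kx hu.1 hu.2 a), stat_mem3 hD _ _⟩
      · exact Finset.mem_product.2 ⟨stat_mem3 hD _ _, stat_mem2 hD hu.2 (ky hu.1 hu.2 b)⟩
      · refine Finset.mem_erase.2 ⟨?_, Finset.mem_product.2 ⟨stat_mem3 hD _ _, stat_mem3 hD _ _⟩⟩
        intro hst
        simp only [stat, Prod.mk.injEq] at hst
        exact no_tri hF (mem_Delta.2 ⟨hu.1, hst.1.2, hst.1.1⟩) h1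
          (mem_Delta.2 ⟨hu.2, hst.2.2, hst.2.1⟩)
  · intro E hE E' hE' heq
    have hE := (Finset.mem_filter.1 hE).2
    have hE' := (Finset.mem_filter.1 hE').2
    refine eq_of_agree {x, y} (fun a b ha hb => (hE a b ha hb).trans (hE' a b ha hb).symm) ?_
    intro q hq u
    have := congrFun heq u
    simp only [Prod.mk.injEq] at this
    simp only [Finset.mem_insert, Finset.mem_singleton] at hq
    rcases hq with rfl | rfl
    · exact this.1
    · exact this.2

/-! ### The bad classes -/

noncomputable def bad1 (n k : ℕ) : Finset (Fin n → Fin n → Bool) :=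
  (Fset n).filter fun E => ∃ v, (DeltaOn n E v).card ≤ k

noncomputable def bad2 (n k : ℕ) : Finset (Fin n → Fin n → Bool) :=
  (Fset n).filter fun E => ∃ Q : Finset (Fin n), Q.card = k ∧ 300 * (Gam n E Q).card ≤ 149 * n

noncomputable def bad3 (n k : ℕ) : Finset (Fin n → Fin n → Bool) :=
  (Fset n).filter fun E => ∃ v, ∃ Q : Finset (Fin n), Q.card = k + 1 ∧
    Q ⊆ DeltaOn n E v ∧ 151 * n ≤ 300 * (Gam n E Q).card

noncomputable def bad4 (n k : ℕ) : Finset (Fin n → Fin n → Bool) :=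
  (Fset n).filter fun E => ∃ x y, ∃ Qx Qy : Finset (Fin n), Qx.card = k ∧ Qy.card = k ∧
    (x ∈ DeltaOn n E y ∧ Qx ⊆ DeltaOn n E x ∧ Qy ⊆ DeltaOn n E y ∧
      y ∉ Qx ∧ x ∉ Qy ∧ 149 * n ≤ 300 * (Gam n E Qx).card ∧ 149 * n ≤ 300 * (Gam n E Qy).card ∧
      n ≤ 50 * (Gam n E Qx ∩ Gam n E Qy).card)

lemma card_psc (n k : ℕ) :
    (Finset.powersetCard k (Finset.univ : Finset (Fin n))).card ≤ n ^ k := by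
  rw [Finset.card_powersetCard, Finset.card_univ, Fintype.card_fin]
  exact Nat.choose_le_pow n k

lemma card_bad1 {n k : ℕ} (hk : k ≤ n) :
    (bad1 n k).card ≤ (n * n ^ k) * ((3 ^ k * 2 ^ n) * (Fset (n - 1)).card) := by
  have hsub : bad1 n k ⊆ ((Finset.univ : Finset (Fin n)) ×ˢ
      Finset.powersetCard k (Finset.univ : Finset (Fin n))).biUnion
      (fun p => (Fset n).filter (fun E => DeltaOn n E p.1 ⊆ p.2)) := by
    intro E hE
    obtain ⟨hF, v, hv⟩ := Finset.mem_filter.1 hE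
    obtain ⟨N, hN, -, hc⟩ := Finset.exists_subsuperset_card_eq
      (Finset.subset_univ (DeltaOn n E v)) hv (by simpa using hk)
    refine Finset.mem_biUnion.2 ⟨(v, N), ?_, Finset.mem_filter.2 ⟨hF, hN⟩⟩
    simp [hc]
  refine (Finset.card_le_card hsub).trans ?_
  refine (Finset.card_biUnion_le_card_mul _ _ ((3 ^ k * 2 ^ n) * (Fset (n - 1)).card) ?_).trans ?_
  · rintro ⟨v, N⟩ hp
    simp only [Finset.mem_product, Finset.mem_powersetCard] at hp
    exact count_bad1 v N hp.2.2
  · refine Nat.mul_le_mul_right _ ?_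
    rw [Finset.card_product, Finset.card_univ, Fintype.card_fin]
    exact Nat.mul_le_mul_left _ (card_psc n k)

lemma card_bad2 {n k : ℕ} (M : ℕ)
    (hM : ∀ r, r ≤ n → 300 * r ≤ 149 * n → 3 ^ r * 2 ^ (n - r) ≤ M) :
    (bad2 n k).card ≤ (2 ^ n * 2 ^ n) * (M ^ k * (Fset (n - k)).card) := by
  have hsub : bad2 n k ⊆ (((Finset.univ : Finset (Finset (Fin n))) ×ˢ
      (Finset.univ : Finset (Finset (Fin n)))).filter
        (fun p => p.1.card = k ∧ 300 * p.2.card ≤ 149 * n)).biUnion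
      (fun p => (Fset n).filter (fun E => Gam n E p.1 = p.2)) := by
    intro E hE
    obtain ⟨hF, Q, hQ, hG⟩ := Finset.mem_filter.1 hE
    refine Finset.mem_biUnion.2 ⟨(Q, Gam n E Q), ?_, Finset.mem_filter.2 ⟨hF, rfl⟩⟩
    simp [hQ, hG]
  refine (Finset.card_le_card hsub).trans ?_
  refine (Finset.card_biUnion_le_card_mul _ _ (M ^ k * (Fset (n - k)).card) ?_).trans ?_
  · rintro ⟨Q, R⟩ hp
    have hp := (Finset.mem_filter.1 hp).2
    exact count_bad2 Q R hp.1 M hM hp.2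
  · refine Nat.mul_le_mul_right _ ((Finset.card_filter_le _ _).trans ?_)
    rw [Finset.card_product]
    simp

lemma card_bad3 {n k : ℕ} (M : ℕ)
    (hM : ∀ r, r ≤ n → 300 * r ≤ 149 * n → 3 ^ r * 2 ^ (n - r) ≤ M) :
    (bad3 n k).card ≤ (n * n ^ (k + 1)) * (M * (Fset (n - 1)).card) := by
  have hsub : bad3 n k ⊆ ((Finset.univ : Finset (Fin n)) ×ˢ
      Finset.powersetCard (k + 1) (Finset.univ : Finset (Fin n))).biUnion
      (fun p => (Fset n).filter
        (fun E => p.2 ⊆ DeltaOn n E p.1 ∧ 151 * n ≤ 300 * (Gam n E p.2).card)) := by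
    intro E hE
    obtain ⟨hF, v, Q, hQ, h⟩ := Finset.mem_filter.1 hE
    refine Finset.mem_biUnion.2 ⟨(v, Q), ?_, Finset.mem_filter.2 ⟨hF, h⟩⟩
    simp [hQ]
  refine (Finset.card_le_card hsub).trans ?_
  refine (Finset.card_biUnion_le_card_mul _ _ (M * (Fset (n - 1)).card) ?_).trans ?_
  · rintro ⟨v, Q⟩ hp
    exact count_bad3 v Q M hM
  · refine Nat.mul_le_mul_right _ ?_
    rw [Finset.card_product, Finset.card_univ, Fintype.card_fin]
    exact Nat.mul_le_mul_left _ (card_psc n _)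

lemma card_bad4 {n k : ℕ} (M : ℕ)
    (hM : ∀ p q, p + q ≤ n → n ≤ 50 * p → 150 * q ≤ 150 * p + n →
      4 ^ p * 6 ^ (n - p - q) * 8 ^ q ≤ M) :
    (bad4 n k).card ≤ ((n * n) * (n ^ k * n ^ k)) * (M * (Fset (n - 2)).card) := by
  have hsub : bad4 n k ⊆ (((Finset.univ : Finset (Fin n)) ×ˢ (Finset.univ : Finset (Fin n))) ×ˢ
      (Finset.powersetCard k (Finset.univ : Finset (Fin n)) ×ˢ
       Finset.powersetCard k (Finset.univ : Finset (Fin n)))).biUnion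
      (fun p => (Fset n).filter
        (fun E => p.1.1 ∈ DeltaOn n E p.1.2 ∧ p.2.1 ⊆ DeltaOn n E p.1.1 ∧
      p.2.2 ⊆ DeltaOn n E p.1.2 ∧
      p.1.2 ∉ p.2.1 ∧ p.1.1 ∉ p.2.2 ∧ 149 * n ≤ 300 * (Gam n E p.2.1).card ∧
      149 * n ≤ 300 * (Gam n E p.2.2).card ∧
      n ≤ 50 * (Gam n E p.2.1 ∩ Gam n E p.2.2).card)) := by
    intro E hE
    obtain ⟨hF, x, y, Qx, Qy, h1, h2, h⟩ := Finset.mem_filter.1 hE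
    refine Finset.mem_biUnion.2 ⟨((x, y), (Qx, Qy)), ?_, Finset.mem_filter.2 ⟨hF, h⟩⟩
    simp [h1, h2]
  refine (Finset.card_le_card hsub).trans ?_
  refine (Finset.card_biUnion_le_card_mul _ _ (M * (Fset (n - 2)).card) ?_).trans ?_
  · rintro ⟨⟨x, y⟩, ⟨Qx, Qy⟩⟩ hp
    exact count_bad4 x y Qx Qy M hM
  · refine Nat.mul_le_mul_right _ ?_
    rw [Finset.card_product, Finset.card_product, Finset.card_product, Finset.card_univ,
      Fintype.card_fin]
    exact Nat.mul_le_mul_left _ (Nat.mul_le_mul (card_psc n _) (card_psc n _))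

/-! ### Structure of good digraphs -/

/-- Hamming distance of sets -/
noncomputable def hd {n : ℕ} (A B : Finset (Fin n)) : ℕ := (symmDiff A B).card

lemma hd_comm {n : ℕ} (A B : Finset (Fin n)) : hd A B = hd B A := by
  unfold hd; rw [symmDiff_comm]

lemma hd_tri {n : ℕ} (A B C : Finset (Fin n)) : hd A C ≤ hd A B + hd B C := by
  unfold hd
  refine (Finset.card_le_card ?_).trans (Finset.card_union_le _ _)
  exact symmDiff_triangle A B C

lemma hd_three {n : ℕ} (A B C : Finset (Fin n)) : hd A B + hd B C + hd A C ≤ 2 * n := by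
  unfold hd
  have h : symmDiff A C ⊆ (symmDiff A B)ᶜ ∪ (symmDiff B C)ᶜ := by
    intro u
    simp only [Finset.mem_symmDiff, Finset.mem_union, Finset.mem_compl]
    tauto
  have h1 := (Finset.card_le_card h).trans (Finset.card_union_le _ _)
  rw [Finset.card_compl, Finset.card_compl, Fintype.card_fin] at h1
  have h2 : (symmDiff A B).card ≤ n := by simpa using Finset.card_le_univ (symmDiff A B)
  have h3 : (symmDiff B C).card ≤ n := by simpa using Finset.card_le_univ (symmDiff B C)
  omega

lemma hd_inter {n : ℕ} (A B : Finset (Fin n)) :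
    hd A B + 2 * (A ∩ B).card = A.card + B.card := by
  unfold hd
  have h1 := Finset.card_sdiff_add_card_inter A B
  have h2 := Finset.card_sdiff_add_card_inter B A
  rw [Finset.inter_comm] at h2
  have h3 : (symmDiff A B).card = (A \ B).card + (B \ A).card := by
    rw [symmDiff_def]
    exact Finset.card_union_of_disjoint disjoint_sdiff_sdiff
  omega

lemma good_bitourn {n k : ℕ} (hn : 1 ≤ n) {E : Fin n → Fin n → Bool} (hE : E ∈ Fset n)
    (h1 : E ∉ bad1 n k) (h2 : E ∉ bad2 n k) (h3 : E ∉ bad3 n k) (h4 : E ∉ bad4 n k) :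
    E ∈ Tset n := by
  have h1' : ∀ v, k + 1 ≤ (DeltaOn n E v).card := by
    intro v; by_contra hc
    exact h1 (Finset.mem_filter.2 ⟨hE, v, by omega⟩)
  have h2' : ∀ Q : Finset (Fin n), Q.card = k → 149 * n < 300 * (Gam n E Q).card := by
    intro Q hQ; by_contra hc
    exact h2 (Finset.mem_filter.2 ⟨hE, Q, hQ, by omega⟩)
  have h3' : ∀ v, ∀ Q : Finset (Fin n), Q.card = k + 1 → Q ⊆ DeltaOn n E v →
      300 * (Gam n E Q).card < 151 * n := by
    intro v Q hQ hs; by_contra hc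
    exact h3 (Finset.mem_filter.2 ⟨hE, v, Q, hQ, hs, by omega⟩)
  choose Q hQs hQc using fun v => Finset.exists_subset_card_eq (h1' v)
  have gmono : ∀ A B : Finset (Fin n), A ⊆ B → Gam n E A ⊆ Gam n E B :=
    fun A B h => Finset.biUnion_subset_biUnion_of_subset_left _ h
  have sub : ∀ z w, ∃ P : Finset (Fin n), P ⊆ Q z ∧ w ∉ P ∧ P.card = k := by
    intro z w
    have : k ≤ ((Q z).erase w).card := by
      have := Finset.pred_card_le_card_erase (s := Q z) (a := w)
      rw [hQc] at this; omega
    obtain ⟨P, hP, hc⟩ := Finset.exists_subset_card_eq this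
    exact ⟨P, hP.trans (Finset.erase_subset _ _), fun h => by simpa using hP h, hc⟩
  set R : Fin n → Finset (Fin n) := fun v => Gam n E (Q v) with hR
  have up : ∀ z, 300 * (R z).card < 151 * n := fun z => h3' z _ (hQc z) (hQs z)
  have low : ∀ z, 149 * n < 300 * (R z).card := by
    intro z
    obtain ⟨P, hP, -, hc⟩ := sub z z
    have := h2' P hc
    have := Finset.card_le_card (gmono _ _ hP)
    simp only [hR]; omega
  have inter : ∀ z w, z ∈ DeltaOn n E w → 300 * (R z ∩ R w).card < 10 * n := by
    intro z w hzw
    obtain ⟨P, hP, hwP, hPc⟩ := sub z w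
    obtain ⟨P', hP', hzP, hPc'⟩ := sub w z
    have l1 := h2' P hPc
    have l2 := h2' P' hPc'
    have hI : 50 * (Gam n E P ∩ Gam n E P').card < n := by
      by_contra hc
      exact h4 (Finset.mem_filter.2 ⟨hE, z, w, P, P', hPc, hPc', hzw, hP.trans (hQs z),
        hP'.trans (hQs w), hwP, hzP, l1.le, l2.le, by omega⟩)
    have hs : R z ∩ R w ⊆ (Gam n E P ∩ Gam n E P') ∪
        ((R z \ Gam n E P) ∪ (R w \ Gam n E P')) := by
      intro u
      simp only [Finset.mem_inter, Finset.mem_union, Finset.mem_sdiff]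
      tauto
    have c1 := Finset.card_le_card hs
    have c2 := Finset.card_union_le (Gam n E P ∩ Gam n E P')
        ((R z \ Gam n E P) ∪ (R w \ Gam n E P'))
    have c3 := Finset.card_union_le (R z \ Gam n E P) (R w \ Gam n E P')
    have c4 := Finset.card_sdiff_add_card_eq_card (gmono _ _ hP)
    have c5 := Finset.card_sdiff_add_card_eq_card (gmono _ _ hP')
    have u1 := up z
    have u2 := up w
    simp only [hR] at *
    omega
  have edge : ∀ z w, z ∈ DeltaOn n E w → 278 * n < 300 * hd (R z) (R w) := by
    intro z w hzw
    have := inter z w hzw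
    have := hd_inter (R z) (R w)
    have := low z
    have := low w
    omega
  have two : ∀ z u, u ∈ R z → 300 * hd (R z) (R u) < 44 * n := by
    intro z u hu
    obtain ⟨q, hq, huq⟩ := mem_Gam.1 hu
    have e1 := edge _ _ (hQs z hq)
    have e2 := edge _ _ huq
    have := hd_three (R z) (R q) (R u)
    rw [hd_comm (R q) (R z)] at e1
    rw [hd_comm (R u) (R q)] at e2
    omega
  let x : Fin n := ⟨0, hn⟩
  obtain ⟨w, hw⟩ : ∃ w, w ∈ DeltaOn n E x := by
    have := h1' x
    exact Finset.card_pos.1 (by omega)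
  have dich : ∀ z, 300 * hd (R z) (R x) < 88 * n ∨ 190 * n < 300 * hd (R z) (R x) := by
    intro z
    have hu := Finset.card_union_add_card_inter (R x) (R w)
    have hi := inter w x hw
    rw [Finset.inter_comm] at hi
    have lx := low x
    have lw := low w
    have lz := low z
    have hne : ((R x ∪ R w) ∩ R z).Nonempty := by
      rw [← Finset.card_pos]
      have h5 := Finset.card_union_add_card_inter (R x ∪ R w) (R z)
      have h6 : ((R x ∪ R w) ∪ R z).card ≤ n := by
        simpa using Finset.card_le_univ ((R x ∪ R w) ∪ R z)
      omega
    obtain ⟨u, hu⟩ := hne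
    rw [Finset.mem_inter, Finset.mem_union] at hu
    have a1 := two z u hu.2
    rcases hu.1 with h | h
    · left
      have a2 := two x u h
      have := hd_tri (R z) (R u) (R x)
      rw [hd_comm (R u) (R x)] at this
      omega
    · right
      have a2 := two w u h
      have e := edge w x hw
      have t1 := hd_tri (R w) (R z) (R x)
      have t2 := hd_tri (R w) (R u) (R z)
      rw [hd_comm (R u) (R z)] at t2
      omega
  rw [mem_Tset]
  refine ⟨(mem_Fset.1 hE).1, Finset.univ.filter (fun z => 300 * hd (R z) (R x) < 88 * n), ?_, ?_⟩
  · intro a ha b hb hab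
    have ha := (Finset.mem_filter.1 ha).2
    have hb := (Finset.mem_filter.1 hb).2
    by_contra hc
    push Not at hc
    have e := edge a b (mem_Delta.2 ⟨hab, by simpa using hc.1, by simpa using hc.2⟩)
    have := hd_tri (R a) (R x) (R b)
    rw [hd_comm (R x) (R b)] at this
    omega
  · intro a ha b hb hab
    have ha : ¬ (300 * hd (R a) (R x) < 88 * n) := by simpa using ha
    have hb : ¬ (300 * hd (R b) (R x) < 88 * n) := by simpa using hb
    have ha := (dich a).resolve_left ha
    have hb := (dich b).resolve_left hb
    by_contra hc
    push Not at hc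
    have e := edge a b (mem_Delta.2 ⟨hab, by simpa using hc.1, by simpa using hc.2⟩)
    have := hd_three (R a) (R b) (R x)
    omega

lemma card_F_le {n : ℕ} (k : ℕ) (hn : 1 ≤ n) :
    (Fset n).card ≤ (Tset n).card + (bad1 n k).card + (bad2 n k).card + (bad3 n k).card
      + (bad4 n k).card := by
  have hs : Fset n ⊆ (((Tset n ∪ bad1 n k) ∪ bad2 n k) ∪ bad3 n k) ∪ bad4 n k := by
    intro E hE
    simp only [Finset.mem_union]
    by_contra hc
    push Not at hc
    obtain ⟨⟨⟨⟨h0, h1⟩, h2⟩, h3⟩, h4⟩ := hc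
    exact h0 (good_bitourn hn hE h1 h2 h3 h4)
  have := Finset.card_le_card hs
  have := Finset.card_union_le (((Tset n ∪ bad1 n k) ∪ bad2 n k) ∪ bad3 n k) (bad4 n k)
  have := Finset.card_union_le ((Tset n ∪ bad1 n k) ∪ bad2 n k) (bad3 n k)
  have := Finset.card_union_le (Tset n ∪ bad1 n k) (bad2 n k)
  have := Finset.card_union_le (Tset n) (bad1 n k)
  omega

/-! ### Growth of the number of bitournaments -/

def extE {n : ℕ} (E : Fin n → Fin n → Bool) (c : Fin n → Bool × Bool) :
    Fin (n + 1) → Fin (n + 1) → Bool :=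
  fun a b => Fin.cases (Fin.cases false (fun j => (c j).1) b)
    (fun i => Fin.cases (c i).2 (fun j => E i j) b) a

@[simp] lemma extE_00 {n : ℕ} (E : Fin n → Fin n → Bool) (c : Fin n → Bool × Bool) :
    extE E c 0 0 = false := rfl
@[simp] lemma extE_0s {n : ℕ} (E : Fin n → Fin n → Bool) (c : Fin n → Bool × Bool) (j : Fin n) :
    extE E c 0 j.succ = (c j).1 := rfl
@[simp] lemma extE_s0 {n : ℕ} (E : Fin n → Fin n → Bool) (c : Fin n → Bool × Bool) (i : Fin n) :
    extE E c i.succ 0 = (c i).2 := rfl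
@[simp] lemma extE_ss {n : ℕ} (E : Fin n → Fin n → Bool) (c : Fin n → Bool × Bool) (i j : Fin n) :
    extE E c i.succ j.succ = E i j := rfl

lemma T_growth {n : ℕ} (M : ℕ) (hM : ∀ p, p ≤ n → n ≤ 2 * p → M ≤ 3 ^ p * 2 ^ (n - p)) :
    (Tset n).card * M ≤ (Tset (n + 1)).card := by
  have hex : ∀ E : Fin n → Fin n → Bool, ∃ P : Finset (Fin n), n ≤ 2 * P.card ∧
      (E ∈ Tset n → IndTournOn n E P ∧ IndTournOn n E Pᶜ) := by
    intro E
    by_cases hE : E ∈ Tset n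
    · obtain ⟨hd, S, h1, h2⟩ := mem_Tset.1 hE
      have hc : (Sᶜ).card = n - S.card := by rw [Finset.card_compl, Fintype.card_fin]
      by_cases h : n ≤ 2 * S.card
      · exact ⟨S, h, fun _ => ⟨h1, h2⟩⟩
      · exact ⟨Sᶜ, by omega, fun _ => ⟨h2, by rwa [compl_compl]⟩⟩
    · exact ⟨Finset.univ, by simp; omega, fun h => absurd h hE⟩
  choose P hP1 hP2 using hex
  let A : (Fin n → Fin n → Bool) → Finset (Fin n → Bool × Bool) :=
    fun E => Fintype.piFinset (fun u => if u ∈ P E then st3 else st2)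
  have hA : ∀ E, M ≤ (A E).card := by
    intro E
    have hle : (P E).card ≤ n := by simpa using Finset.card_le_univ (P E)
    refine (hM _ hle (hP1 E)).trans (le_of_eq ?_)
    simp only [A, Fintype.card_piFinset]
    have : ∀ u, (if u ∈ P E then st3 else st2).card = if u ∈ P E then 3 else 2 := by
      intro u; split_ifs <;> rfl
    simp only [this]
    rw [Finset.prod_ite]
    simp only [Finset.prod_const]
    congr 2
    · simp
    · rw [Finset.filter_not, Finset.card_sdiff]; simp
  have hc : (Tset n).card * M ≤ ((Tset n).sigma A).card := by
    rw [Finset.card_sigma]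
    simpa using Finset.card_nsmul_le_sum (Tset n) (fun E => (A E).card) M (fun E _ => hA E)
  refine hc.trans (Finset.card_le_card_of_injOn (fun p => extE p.1 p.2) ?_ ?_)
  · rintro ⟨E, c⟩ hp
    obtain ⟨hE, hcA⟩ := Finset.mem_sigma.1 hp
    have hcm : ∀ u, c u ∈ if u ∈ P E then st3 else st2 := Fintype.mem_piFinset.1 hcA
    have hc3 : ∀ u, (c u).1 = true → (c u).2 = false := by
      intro u
      have := hcm u
      split_ifs at this with h
      · simp only [st3, Finset.mem_insert, Finset.mem_singleton] at this
        rcases this with h | h | h <;> simp [h]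
      · simp only [st2, Finset.mem_insert, Finset.mem_singleton] at this
        rcases this with h | h <;> simp [h]
    have hc2 : ∀ u, u ∉ P E → (c u).1 = true ∨ (c u).2 = true := by
      intro u hu
      have := hcm u
      rw [if_neg hu] at this
      simp only [st2, Finset.mem_insert, Finset.mem_singleton] at this
      rcases this with h | h <;> simp [h]
    have hEd := (mem_Tset.1 hE).1
    obtain ⟨t1, t2⟩ := hP2 E hE
    show extE E c ∈ Tset (n + 1)
    rw [mem_Tset]
    refine ⟨⟨?_, ?_⟩, (P E).map (Fin.succEmb n), ?_, ?_⟩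
    · intro x
      refine Fin.cases ?_ (fun i => ?_) x
      · simp
      · simpa using hEd.1 i
    · intro x y
      refine Fin.cases ?_ (fun i => ?_) x <;> refine Fin.cases ?_ (fun j => ?_) y
      · simp
      · simpa using hc3 j
      · have := hc3 i
        simp only [extE_s0, extE_0s]
        intro h
        by_contra h'
        have := this (by simpa using h')
        simp_all
      · simpa using hEd.2 i j
    · intro x hx y hy hxy
      obtain ⟨i, hi, rfl⟩ := Finset.mem_map.1 hx
      obtain ⟨j, hj, rfl⟩ := Finset.mem_map.1 hy
      have := t1 i hi j hj (by rintro rfl; exact hxy rfl)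
      simpa using this
    · intro x
      refine Fin.cases ?_ (fun i => ?_) x <;> intro hx y <;> refine Fin.cases ?_ (fun j => ?_) y <;>
        intro hy hxy
      · exact absurd rfl hxy
      · have hj : j ∉ P E := by simpa using hy
        simpa using hc2 j hj
      · have hi : i ∉ P E := by simpa using hx
        simpa [or_comm] using hc2 i hi
      · have hi : i ∉ P E := by simpa using hx
        have hj : j ∉ P E := by simpa using hy
        have := t2 i (by simpa using hi) j (by simpa using hj) (by rintro rfl; exact hxy rfl)
        simpa using this
  · rintro ⟨E, c⟩ _ ⟨E', c'⟩ _ heq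
    have heq : extE E c = extE E' c' := heq
    have h1 : E = E' := by
      funext i j
      simpa using congrFun (congrFun heq i.succ) j.succ
    have h2 : c = c' := by
      funext i
      refine Prod.ext ?_ ?_
      · simpa using congrFun (congrFun heq 0) i.succ
      · simpa using congrFun (congrFun heq i.succ) 0
    subst h1; subst h2; rfl

lemma T_pos (n : ℕ) : 0 < (Tset n).card := by
  induction n with
  | zero =>
    refine Finset.card_pos.2 ⟨fun x _ => x.elim0, mem_Tset.2 ⟨⟨fun x => x.elim0, fun x => x.elim0⟩,
      ∅, fun x => x.elim0, fun x => x.elim0⟩⟩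
  | succ n ih =>
    have := T_growth (n := n) 1 (fun p _ _ => Nat.one_le_iff_ne_zero.2 (by positivity))
    omega

/-! ### Analysis -/

/-- `log √6` -/
noncomputable def LL : ℝ := (Real.log 3 + Real.log 2) / 2

lemma LL_pos : 0 < LL := by
  have := Real.log_pos (show (1:ℝ) < 3 by norm_num)
  have := Real.log_pos (show (1:ℝ) < 2 by norm_num)
  unfold LL; linarith

lemma log23 : Real.log 2 < Real.log 3 := Real.log_lt_log (by norm_num) (by norm_num)

lemma pow_eq_exp (a : ℝ) (ha : 0 < a) (m : ℕ) : a ^ m = Real.exp (m * Real.log a) := by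
  rw [Real.exp_nat_mul, Real.exp_log ha]

lemma exp32 {p n : ℕ} (hp : p ≤ n) : ((3 ^ p * 2 ^ (n - p) : ℕ) : ℝ) =
    Real.exp (p * Real.log 3 + (n - p) * Real.log 2) := by
  push_cast
  rw [pow_eq_exp 3 (by norm_num), pow_eq_exp 2 (by norm_num), ← Real.exp_add, Nat.cast_sub hp]

lemma T_step (n : ℕ) : ((Tset n).card : ℝ) * Real.exp (n * LL) ≤ (Tset (n + 1)).card := by
  have h := T_growth (n := n) ⌈Real.exp (n * LL)⌉₊ (by
    intro p hp h2
    rw [Nat.ceil_le, exp32 hp]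
    apply Real.exp_le_exp.2
    have h2' : (n : ℝ) ≤ 2 * p := by exact_mod_cast h2
    have := log23
    unfold LL
    nlinarith)
  have h' : ((Tset n).card : ℝ) * (⌈Real.exp (n * LL)⌉₊ : ℝ) ≤ (Tset (n + 1)).card := by
    exact_mod_cast h
  refine le_trans ?_ h'
  exact mul_le_mul_of_nonneg_left (Nat.le_ceil _) (by positivity)

lemma T_steps (m k : ℕ) : ((Tset m).card : ℝ) * Real.exp (k * (m * LL)) ≤ (Tset (m + k)).card := by
  induction k with
  | zero => simp
  | succ k ih =>
    have h := T_step (m + k)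
    have hL := LL_pos
    rw [← add_assoc]
    refine le_trans ?_ h
    refine le_trans ?_ (mul_le_mul_of_nonneg_right ih (Real.exp_pos _).le)
    rw [mul_assoc, ← Real.exp_add]
    refine mul_le_mul_of_nonneg_left (Real.exp_le_exp.2 ?_) (by positivity)
    push_cast
    nlinarith [mul_nonneg (Nat.cast_nonneg (α := ℝ) k) hL.le]

/-- the ratio -/
noncomputable def ratio (n : ℕ) : ℝ := ((Fset n).card : ℝ) / ((Tset n).card : ℝ)

lemma F_le (n k : ℕ) (hk : k ≤ n) : ((Fset (n - k)).card : ℝ) ≤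
    ratio (n - k) * (Tset n).card * (Real.exp (k * k * LL) * Real.exp (- (k * LL * n))) := by
  have h := T_steps (n - k) k
  rw [Nat.sub_add_cancel hk] at h
  have hT : (0 : ℝ) < (Tset (n - k)).card := by exact_mod_cast T_pos _
  have e : ((Fset (n - k)).card : ℝ) = ratio (n - k) * (Tset (n - k)).card := by
    unfold ratio; field_simp
  have hr : 0 ≤ ratio (n - k) := by unfold ratio; positivity
  rw [e, mul_assoc]
  refine mul_le_mul_of_nonneg_left ?_ hr
  rw [← Real.exp_add]
  have h2 := mul_le_mul_of_nonneg_right h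
    (Real.exp_pos (k * k * LL + -(k * LL * n))).le
  rw [mul_assoc, ← Real.exp_add, Nat.cast_sub hk] at h2
  have : (k:ℝ) * ((n - k) * LL) + (k * k * LL + -(k * LL * n)) = 0 := by ring
  rw [this] at h2
  simpa using h2

lemma logs1 : 3 * Real.log 2 < 2 * Real.log 3 := by
  have h : Real.log ((2:ℝ)^3) < Real.log ((3:ℝ)^2) := Real.log_lt_log (by norm_num) (by norm_num)
  rw [Real.log_pow, Real.log_pow] at h
  exact_mod_cast h

lemma logs2 : 11 * Real.log 2 < 7 * Real.log 3 := by
  have h : Real.log ((2:ℝ)^11) < Real.log ((3:ℝ)^7) := Real.log_lt_log (by norm_num) (by norm_num)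
  rw [Real.log_pow, Real.log_pow] at h
  exact_mod_cast h

lemma logs3 : Real.log 3 < 2 * Real.log 2 := by
  have h : Real.log (3:ℝ) < Real.log ((2:ℝ)^2) := Real.log_lt_log (by norm_num) (by norm_num)
  rw [Real.log_pow] at h
  exact_mod_cast h

lemma hM3 (n : ℕ) : ∀ r, r ≤ n → 300 * r ≤ 149 * n → 3 ^ r * 2 ^ (n - r) ≤
    ⌊Real.exp (n * LL - n * ((Real.log 3 - Real.log 2) / 300))⌋₊ := by
  intro r hr h
  apply Nat.le_floor
  rw [exp32 hr]
  apply Real.exp_le_exp.2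
  have h' : (300 : ℝ) * r ≤ 149 * n := by exact_mod_cast h
  have := log23
  unfold LL
  nlinarith

lemma hM4 (n : ℕ) : ∀ p q, p + q ≤ n → n ≤ 50 * p → 150 * q ≤ 150 * p + n →
      4 ^ p * 6 ^ (n - p - q) * 8 ^ q ≤
    ⌊Real.exp (2 * n * LL - n * ((7 * Real.log 3 - 11 * Real.log 2) / 150))⌋₊ := by
  intro p q hpq h1 h2
  apply Nat.le_floor
  push_cast
  have e4 : Real.log 4 = 2 * Real.log 2 := by
    rw [show (4:ℝ) = 2 ^ 2 by norm_num, Real.log_pow]; norm_num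
  have e8 : Real.log 8 = 3 * Real.log 2 := by
    rw [show (8:ℝ) = 2 ^ 3 by norm_num, Real.log_pow]; norm_num
  have e6 : Real.log 6 = Real.log 2 + Real.log 3 := by
    rw [show (6:ℝ) = 2 * 3 by norm_num, Real.log_mul (by norm_num) (by norm_num)]
  rw [pow_eq_exp 4 (by norm_num), pow_eq_exp 6 (by norm_num), pow_eq_exp 8 (by norm_num),
    ← Real.exp_add, ← Real.exp_add, Nat.cast_sub (by omega), Nat.cast_sub (by omega), e4, e8, e6]
  apply Real.exp_le_exp.2
  have h1' : (n : ℝ) ≤ 50 * p := by exact_mod_cast h1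
  have h2' : (150 : ℝ) * q ≤ 150 * p + n := by exact_mod_cast h2
  have l1 := logs1
  have l3 := logs3
  unfold LL
  have t1 := mul_le_mul_of_nonneg_right h2' (sub_nonneg.2 l3.le)
  have t2 := mul_le_mul_of_nonneg_right h1' (sub_nonneg.2 l1.le)
  nlinarith

lemma bound1 (k : ℕ) : ∃ C : ℝ, ∃ K : ℕ, ∃ c : ℝ, 0 ≤ C ∧ 0 < c ∧ ∀ n, k ≤ n → 1 ≤ n →
    ((bad1 n k).card : ℝ) ≤ C * (n ^ K * Real.exp (-c * n)) * (ratio (n - 1) * (Tset n).card) := by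
  refine ⟨3 ^ k * Real.exp LL, k + 1, LL - Real.log 2, by positivity, ?_, ?_⟩
  · have := log23; unfold LL; linarith
  intro n hk hn
  have h := card_bad1 hk
  have h' : ((bad1 n k).card : ℝ) ≤ (n * n ^ k) * ((3 ^ k * 2 ^ n) * (Fset (n - 1)).card) := by
    exact_mod_cast h
  have hF := F_le n 1 hn
  refine h'.trans ((mul_le_mul_of_nonneg_left (mul_le_mul_of_nonneg_left hF
    (by positivity)) (by positivity)).trans (le_of_eq ?_))
  have e : Real.exp (-(LL - Real.log 2) * n) = 2 ^ n * Real.exp (-(LL * n)) := by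
    rw [pow_eq_exp 2 (by norm_num), ← Real.exp_add]; congr 1; ring
  rw [e]
  simp only [Nat.cast_one, one_mul]
  ring

lemma bound3 (k : ℕ) : ∃ C : ℝ, ∃ K : ℕ, ∃ c : ℝ, 0 ≤ C ∧ 0 < c ∧ ∀ n, k ≤ n → 1 ≤ n →
    ((bad3 n k).card : ℝ) ≤ C * (n ^ K * Real.exp (-c * n)) * (ratio (n - 1) * (Tset n).card) := by
  refine ⟨Real.exp LL, k + 2, (Real.log 3 - Real.log 2) / 300, by positivity, ?_, ?_⟩
  · have := log23; linarith
  intro n hk hn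
  have h := card_bad3 (k := k) _ (hM3 n)
  have h' : ((bad3 n k).card : ℝ) ≤ (n * n ^ (k + 1)) *
      ((⌊Real.exp (n * LL - n * ((Real.log 3 - Real.log 2) / 300))⌋₊ : ℝ)
        * (Fset (n - 1)).card) := by
    exact_mod_cast h
  have hF := F_le n 1 hn
  refine h'.trans ((mul_le_mul_of_nonneg_left (mul_le_mul (Nat.floor_le (Real.exp_pos _).le) hF
    (by positivity) (by positivity)) (by positivity)).trans (le_of_eq ?_))
  have e : Real.exp (-((Real.log 3 - Real.log 2) / 300) * n) =
      Real.exp (n * LL - n * ((Real.log 3 - Real.log 2) / 300)) * Real.exp (-(LL * n)) := by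
    rw [← Real.exp_add]; congr 1; ring
  rw [e]
  simp only [Nat.cast_one, one_mul]
  ring

lemma bound4 (k : ℕ) : ∃ C : ℝ, ∃ K : ℕ, ∃ c : ℝ, 0 ≤ C ∧ 0 < c ∧ ∀ n, k ≤ n → 2 ≤ n →
    ((bad4 n k).card : ℝ) ≤ C * (n ^ K * Real.exp (-c * n)) * (ratio (n - 2) * (Tset n).card) := by
  refine ⟨Real.exp (4 * LL), 2 + 2 * k, (7 * Real.log 3 - 11 * Real.log 2) / 150,
    by positivity, ?_, ?_⟩
  · have := logs2; linarith
  intro n hk hn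
  have h := card_bad4 (k := k) _ (hM4 n)
  have h' : ((bad4 n k).card : ℝ) ≤ ((n * n) * (n ^ k * n ^ k)) *
      ((⌊Real.exp (2 * n * LL - n * ((7 * Real.log 3 - 11 * Real.log 2) / 150))⌋₊ : ℝ)
        * (Fset (n - 2)).card) := by
    exact_mod_cast h
  have hF := F_le n 2 hn
  refine h'.trans ((mul_le_mul_of_nonneg_left (mul_le_mul (Nat.floor_le (Real.exp_pos _).le) hF
    (by positivity) (by positivity)) (by positivity)).trans (le_of_eq ?_))
  have e : Real.exp (-((7 * Real.log 3 - 11 * Real.log 2) / 150) * n) =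
      Real.exp (2 * n * LL - n * ((7 * Real.log 3 - 11 * Real.log 2) / 150)) *
        Real.exp (-(2 * LL * n)) := by
    rw [← Real.exp_add]; congr 1; ring
  have e2 : ((2 : ℕ) : ℝ) * ((2 : ℕ) : ℝ) * LL = 4 * LL := by push_cast; ring
  rw [e, e2]
  push_cast
  ring

lemma bound2 (k : ℕ) (hk1200 : k = 1200) :
    ∃ C : ℝ, ∃ K : ℕ, ∃ c : ℝ, 0 ≤ C ∧ 0 < c ∧ ∀ n, k ≤ n →
    ((bad2 n k).card : ℝ) ≤ C * (n ^ K * Real.exp (-c * n)) * (ratio (n - k) * (Tset n).card) := by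
  refine ⟨Real.exp (k * k * LL), 0, 4 * Real.log 3 - 6 * Real.log 2, by positivity, ?_, ?_⟩
  · have := logs1; linarith
  intro n hk
  have h := card_bad2 (k := k) _ (hM3 n)
  have h' : ((bad2 n k).card : ℝ) ≤ (2 ^ n * 2 ^ n) *
      ((⌊Real.exp (n * LL - n * ((Real.log 3 - Real.log 2) / 300))⌋₊ : ℝ) ^ k
        * (Fset (n - k)).card) := by
    exact_mod_cast h
  have hF := F_le n k hk
  refine h'.trans ((mul_le_mul_of_nonneg_left (mul_le_mul
    (pow_le_pow_left₀ (by positivity) (Nat.floor_le (Real.exp_pos _).le) k) hF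
    (by positivity) (by positivity)) (by positivity)).trans (le_of_eq ?_))
  have hkr : (k : ℝ) = 1200 := by rw [hk1200]; norm_num
  have e : Real.exp (-(4 * Real.log 3 - 6 * Real.log 2) * n) =
      2 ^ n * 2 ^ n * Real.exp (n * LL - n * ((Real.log 3 - Real.log 2) / 300)) ^ k *
        Real.exp (-(k * LL * n)) := by
    rw [pow_eq_exp 2 (by norm_num), ← Real.exp_nat_mul, ← Real.exp_add, ← Real.exp_add,
      ← Real.exp_add]
    congr 1
    rw [hkr]; ring
  rw [e]
  ring

lemma eps_tendsto (C : ℝ) (K : ℕ) (c : ℝ) (hc : 0 < c) :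
    Filter.Tendsto (fun n : ℕ => C * ((n : ℝ) ^ K * Real.exp (-c * n))) Filter.atTop (nhds 0) := by
  have h := tendsto_pow_const_mul_const_pow_of_abs_lt_one K (r := Real.exp (-c)) (by
    rw [abs_of_pos (Real.exp_pos _)]
    exact Real.exp_lt_one_iff.2 (by linarith))
  have h2 := h.const_mul C
  rw [mul_zero] at h2
  refine h2.congr (fun n => ?_)
  rw [← Real.exp_nat_mul]
  congr 3; ring

lemma ratio_nonneg (n : ℕ) : 0 ≤ ratio n := by unfold ratio; positivity

lemma one_le_ratio (n : ℕ) : 1 ≤ ratio n := by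
  unfold ratio
  have hT : (0 : ℝ) < (Tset n).card := by exact_mod_cast T_pos _
  rw [le_div_iff₀ hT, one_mul]
  exact_mod_cast Finset.card_le_card (Tset_sub_Fset n)

lemma rec_tendsto (f : ℕ → ℝ) (hf : ∀ n, 1 ≤ f n) (k : ℕ) (hk : 2 ≤ k) (ε : ℕ → ℝ)
    (hε0 : ∀ n, 0 ≤ ε n)
    (hε : Filter.Tendsto ε Filter.atTop (nhds 0))
    (h : ∀ n, k ≤ n → f n ≤ 1 + ε n * (f (n - 1) + f (n - 2) + f (n - k))) :
    Filter.Tendsto f Filter.atTop (nhds 1) := by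
  obtain ⟨N, hN⟩ := Filter.eventually_atTop.1
    (hε.eventually (gt_mem_nhds (show (0:ℝ) < 1 / 6 by norm_num)))
  obtain ⟨B, hB⟩ : ∃ B : ℝ, ∀ n, f n ≤ B := by
    refine ⟨2 + ∑ i ∈ Finset.range (N + k), f i, ?_⟩
    set B := 2 + ∑ i ∈ Finset.range (N + k), f i with hBdef
    have hB2 : 2 ≤ B := by
      have : 0 ≤ ∑ i ∈ Finset.range (N + k), f i :=
        Finset.sum_nonneg (fun i _ => zero_le_one.trans (hf i))
      linarith
    intro n
    induction n using Nat.strong_induction_on with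
    | _ n ih =>
      by_cases hn : n < N + k
      · have := Finset.single_le_sum (f := f) (fun i _ => zero_le_one.trans (hf i))
          (Finset.mem_range.2 hn)
        linarith
      · push Not at hn
        have h1 := ih (n - 1) (by omega)
        have h2 := ih (n - 2) (by omega)
        have h3 := ih (n - k) (by omega)
        have h4 := h n (by omega)
        have h5 := hN n (by omega)
        have h6 : ε n * (f (n - 1) + f (n - 2) + f (n - k)) ≤ 1 / 6 * (3 * B) :=
          mul_le_mul h5.le (by linarith)
            (by linarith [hf (n - 1), hf (n - 2), hf (n - k)]) (by norm_num)
        linarith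
  have hup : Filter.Tendsto (fun n => 1 + ε n * (3 * B)) Filter.atTop (nhds 1) := by
    have := (hε.mul_const (3 * B)).const_add 1
    simpa using this
  refine tendsto_of_tendsto_of_tendsto_of_le_of_le' tendsto_const_nhds hup
    (Filter.Eventually.of_forall hf) ?_
  filter_upwards [Filter.eventually_ge_atTop k] with n hn
  refine (h n hn).trans ?_
  have := mul_le_mul_of_nonneg_left
    (show f (n - 1) + f (n - 2) + f (n - k) ≤ 3 * B by
      linarith [hB (n - 1), hB (n - 2), hB (n - k)]) (hε0 n)
  linarith

lemma ratio_tendsto (k : ℕ) (hk : k = 1200) : Filter.Tendsto ratio Filter.atTop (nhds 1) := by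
  obtain ⟨C1, K1, c1, hC1, hc1, h1⟩ := bound1 k
  obtain ⟨C2, K2, c2, hC2, hc2, h2⟩ := bound2 k hk
  obtain ⟨C3, K3, c3, hC3, hc3, h3⟩ := bound3 k
  obtain ⟨C4, K4, c4, hC4, hc4, h4⟩ := bound4 k
  have t1 := eps_tendsto C1 K1 c1 hc1
  have t2 := eps_tendsto C2 K2 c2 hc2
  have t3 := eps_tendsto C3 K3 c3 hc3
  have t4 := eps_tendsto C4 K4 c4 hc4
  set e1 := fun n : ℕ => C1 * ((n : ℝ) ^ K1 * Real.exp (-c1 * n)) with he1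
  set e2 := fun n : ℕ => C2 * ((n : ℝ) ^ K2 * Real.exp (-c2 * n)) with he2
  set e3 := fun n : ℕ => C3 * ((n : ℝ) ^ K3 * Real.exp (-c3 * n)) with he3
  set e4 := fun n : ℕ => C4 * ((n : ℝ) ^ K4 * Real.exp (-c4 * n)) with he4
  have p1 : ∀ n, 0 ≤ e1 n := fun n => by simp only [he1]; positivity
  have p2 : ∀ n, 0 ≤ e2 n := fun n => by simp only [he2]; positivity
  have p3 : ∀ n, 0 ≤ e3 n := fun n => by simp only [he3]; positivity
  have p4 : ∀ n, 0 ≤ e4 n := fun n => by simp only [he4]; positivity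
  refine rec_tendsto ratio one_le_ratio k (by omega) (fun n => e1 n + e2 n + e3 n + e4 n)
    (fun n => by linarith [p1 n, p2 n, p3 n, p4 n]) ?_ ?_
  · simpa using ((t1.add t2).add t3).add t4
  · intro n hn
    have b1 : _ ≤ e1 n * (ratio (n - 1) * (Tset n).card) := h1 n hn (by omega)
    have b2 : _ ≤ e2 n * (ratio (n - k) * (Tset n).card) := h2 n hn
    have b3 : _ ≤ e3 n * (ratio (n - 1) * (Tset n).card) := h3 n hn (by omega)
    have b4 : _ ≤ e4 n * (ratio (n - 2) * (Tset n).card) := h4 n hn (by omega)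
    have hF := card_F_le (n := n) k (by omega)
    have hF' : ((Fset n).card : ℝ) ≤ (Tset n).card + (bad1 n k).card + (bad2 n k).card
      + (bad3 n k).card + (bad4 n k).card := by exact_mod_cast hF
    have hT : (0 : ℝ) < (Tset n).card := by exact_mod_cast T_pos _
    have hle : ratio n ≤ 1 + (e1 n * ratio (n - 1) + e2 n * ratio (n - k) + e3 n * ratio (n - 1)
        + e4 n * ratio (n - 2)) := by
      rw [ratio, div_le_iff₀ hT]
      linarith
    refine hle.trans ?_
    have r1 := ratio_nonneg (n - 1)
    have r2 := ratio_nonneg (n - 2)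
    have r3 := ratio_nonneg (n - k)
    have q1 := p1 n
    have q2 := p2 n
    have q3 := p3 n
    have q4 := p4 n
    generalize e1 n = x1 at *
    generalize e2 n = x2 at *
    generalize e3 n = x3 at *
    generalize e4 n = x4 at *
    nlinarith [mul_nonneg q1 r2, mul_nonneg q1 r3, mul_nonneg q2 r1, mul_nonneg q2 r2,
      mul_nonneg q3 r2, mul_nonneg q3 r3, mul_nonneg q4 r1, mul_nonneg q4 r3]

/-- Almost all I₃-free digraphs are bitournaments: `F(n) = T(n)·(1 + o(1))`. -/
theorem Fcard_eq_Tcard_mul_one_add_littleO :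
    Filter.Tendsto (fun n => ((Fset n).card : ℝ) / ((Tset n).card : ℝ))
      Filter.atTop (nhds 1) :=
  ratio_tendsto 1200 rfl
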